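/- Suppose W is finite with longest element w_S, let s, t ∈ S with s ≠ t̄ (where ū = w_S·u·w_S), let (u_i)_{i ≥ −1} be the rotation sequence associated to (S,s,t), and let d = d(S,s,t). Then u_{d+1} = s̄ = w_S·s·w_S. -/

import Mathlib

namespace CoxeterAtoms

variable {B : Type*} {W : Type*} [Group W] {M : CoxeterMatrix B}

/-- The standard parabolic subgroup `W_K` generated by the simple reflections indexed by `K`. -/
def par (cs : CoxeterSystem M W) (K : Set B) : Subgroup W :=
  Subgroup.closure (cs.simple '' K)

/-- `K` is finitary if `W_K` is finite. -/
def Finitary (cs : CoxeterSystem M W) (K : Set B) : Prop :=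
  ((par cs K : Set W)).Finite

/-- The left coset `W_I · x`. -/
def lcos (cs : CoxeterSystem M W) (I : Set B) (x : W) : Set W :=
  {w | ∃ a ∈ par cs I, w = a * x}

/-- The right coset `x · W_J`. -/
def rcos (cs : CoxeterSystem M W) (x : W) (J : Set B) : Set W :=
  {w | ∃ b ∈ par cs J, w = x * b}

/-- The double coset `W_I · x · W_J`. -/
def dcos (cs : CoxeterSystem M W) (I : Set B) (x : W) (J : Set B) : Set W :=
  {w | ∃ a ∈ par cs I, ∃ b ∈ par cs J, w = a * x * b}

/-- `x` is a minimal length element of its double coset `W_I · x · W_J`. -/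
def IsMinRep (cs : CoxeterSystem M W) (I : Set B) (x : W) (J : Set B) : Prop :=
  ∀ w ∈ dcos cs I x J, cs.length x ≤ cs.length w

/-- `y` is a maximal length element of the set `p`. -/
def IsMaxOf (cs : CoxeterSystem M W) (p : Set W) (y : W) : Prop :=
  y ∈ p ∧ ∀ w ∈ p, cs.length w ≤ cs.length y

/-- `y` is the longest element of the standard parabolic subgroup `W_K`. -/
def IsLongest (cs : CoxeterSystem M W) (K : Set B) (y : W) : Prop :=
  y ∈ par cs K ∧ ∀ w ∈ par cs K, cs.length w ≤ cs.length y

/-- The double coset `W_I · x · W_J` is core: `W_I·x = W_I·x·W_J = x·W_J`. -/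
def IsCore (cs : CoxeterSystem M W) (I : Set B) (x : W) (J : Set B) : Prop :=
  lcos cs I x = dcos cs I x J ∧ dcos cs I x J = rcos cs x J

section inj
open Polynomial.Chebyshev

theorem refl_pow_eq_one {V : Type*} [AddCommGroup V] [Module ℝ V] {x y : V}
    {f g : Module.Dual ℝ V} (hf : f x = 2) (hg : g y = 2) (m : ℕ) (hm : 2 ≤ m)
    (h1 : f y = -2 * Real.cos (Real.pi / m)) (h2 : g x = -2 * Real.cos (Real.pi / m)) :
    (Module.reflection hf * Module.reflection hg) ^ m = 1 := by
  rcases eq_or_lt_of_le hm with rfl | hm3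
  · have e1 : f y = 0 := by rw [h1]; simp
    have e2 : g x = 0 := by rw [h2]; simp
    ext z
    simp only [pow_two, LinearEquiv.mul_apply, Module.reflection_apply, map_sub, map_smul, e1, e2,
      hf, hg, LinearEquiv.coe_one, id]
    module
  · ext z
    have ht : (2 * Real.cos (2 * Real.pi / m)) = f y * g x - 2 := by
      rw [h1, h2, show 2 * Real.pi / m = 2 * (Real.pi / m) by ring, Real.cos_two_mul]; ring
    rw [Module.reflection_mul_reflection_pow_apply hf hg m z _ ht]
    have hmpos : (0 : ℝ) < m := by positivity
    have hsin : Real.sin (2 * Real.pi / m) ≠ 0 := by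
      apply ne_of_gt
      apply Real.sin_pos_of_pos_of_lt_pi
      · positivity
      · rw [div_lt_iff₀ hmpos]
        have : (3 : ℝ) ≤ m := by exact_mod_cast hm3
        nlinarith [Real.pi_pos]
    rcases Nat.even_or_odd' m with ⟨k, hk | hk⟩
    · have hS : (S ℝ ((k : ℤ) - 1)).eval (2 * Real.cos (2 * Real.pi / m)) = 0 := by
        have := S_two_mul_real_cos (2 * Real.pi / m) ((k : ℤ) - 1)
        have h0 : Real.sin ((((k : ℤ) - 1 : ℤ) + 1 : ℝ) * (2 * Real.pi / m)) = 0 := by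
          have : ((((k : ℤ) - 1 : ℤ) + 1 : ℝ) * (2 * Real.pi / m)) = Real.pi := by
            push_cast
            have : (m : ℝ) = 2 * k := by rw [hk]; push_cast; ring
            have hk0 : (k : ℝ) ≠ 0 := by intro h; rw [h] at this; linarith
            rw [this]; field_simp; ring
          rw [this, Real.sin_pi]
        rw [h0] at this
        exact (mul_eq_zero.1 this).resolve_right hsin
      rw [show ((m : ℤ) - 2) / 2 = k - 1 by omega, show ((m : ℤ) - 1) / 2 = k - 1 by omega, hS]
      simp
    · have hS : (S ℝ (k : ℤ)).eval (2 * Real.cos (2 * Real.pi / m)) +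
          (S ℝ ((k : ℤ) - 1)).eval (2 * Real.cos (2 * Real.pi / m)) = 0 := by
        have a1 := S_two_mul_real_cos (2 * Real.pi / m) ((k : ℤ) - 1)
        have a2 := S_two_mul_real_cos (2 * Real.pi / m) (k : ℤ)
        have h0 : ((((k : ℤ) : ℤ) + 1 : ℝ) * (2 * Real.pi / m)) =
            2 * Real.pi - ((((k : ℤ) - 1 : ℤ) + 1 : ℝ) * (2 * Real.pi / m)) := by
          push_cast
          have : (m : ℝ) = 2 * k + 1 := by rw [hk]; push_cast; ring
          rw [this]; field_simp; ring
        rw [h0, Real.sin_two_pi_sub] at a2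
        have : ((S ℝ (k : ℤ)).eval (2 * Real.cos (2 * Real.pi / m)) +
          (S ℝ ((k : ℤ) - 1)).eval (2 * Real.cos (2 * Real.pi / m))) *
            Real.sin (2 * Real.pi / m) = 0 := by rw [add_mul, a1, a2]; ring
        exact (mul_eq_zero.1 this).resolve_right hsin
      rw [show ((m : ℤ) - 2) / 2 = k - 1 by omega, show ((m : ℤ) - 1) / 2 = k by omega,
        show ((m : ℤ) - 3) / 2 = k - 1 by omega, show (m : ℤ) / 2 = k by omega, hS]
      simp

open Classical in
theorem simple_inj (cs : CoxeterSystem M W) : Function.Injective cs.simple := by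
  let k : B → B → ℝ := fun i j => if i = j then 2 else -2 * Real.cos (Real.pi / M i j)
  let f : B → Module.Dual ℝ (B →₀ ℝ) := fun i => Finsupp.linearCombination ℝ (k i)
  let e : B → (B →₀ ℝ) := fun i => Finsupp.single i 1
  have hfe : ∀ i j, f i (e j) = k i j := by intro i j; simp [f, e]
  have hf : ∀ i, f i (e i) = 2 := by intro i; rw [hfe]; simp [k]
  have hl : M.IsLiftable (fun i => Module.reflection (hf i)) := by
    intro i j
    by_cases hij : i = j
    · subst hij
      rw [M.diagonal, pow_one]
      ext1 z
      exact Module.involutive_reflection (hf i) z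
    · rcases Nat.lt_or_ge (M i j) 2 with h | h
      · have h1 := M.off_diagonal i j hij
        have : M i j = 0 := by omega
        rw [this, pow_zero]
      · apply refl_pow_eq_one (hf i) (hf j) _ h
        · rw [hfe]; simp [k, hij]
        · rw [hfe]; simp [k, Ne.symm hij, M.symmetric j i]
  intro a b hab
  by_contra hne
  have h := congrArg (cs.lift ⟨_, hl⟩) hab
  rw [cs.lift_apply_simple hl, cs.lift_apply_simple hl] at h
  have h' := congrArg (fun φ : (B →₀ ℝ) ≃ₗ[ℝ] (B →₀ ℝ) => (φ (e a)) a) h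
  simp only [Module.reflection_apply, hfe] at h'
  simp [k, e, Ne.symm hne] at h'
end inj

section exch
open Classical

/-- Generator of the signed permutation representation. -/
noncomputable def gen (cs : CoxeterSystem M W) (i : B) : Function.End (W × ZMod 2) :=
  fun q => (cs.simple i * q.1 * cs.simple i, q.2 + if q.1 = cs.simple i then 1 else 0)

theorem gen_pow (cs : CoxeterSystem M W) (i j : B) (k : ℕ) (t : W) (ε : ZMod 2) :
    ((gen cs i * gen cs j) ^ k) (t, ε) =
      ((cs.simple i * cs.simple j) ^ k * t * ((cs.simple i * cs.simple j) ^ k)⁻¹,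
        ε + ∑ n ∈ Finset.range (2 * k),
          if t = ((cs.simple i * cs.simple j)⁻¹) ^ n * cs.simple j then 1 else 0) := by
  induction k with
  | zero => simp; rfl
  | succ k ih =>
    rw [pow_succ']
    change (gen cs i) ((gen cs j) (((gen cs i * gen cs j) ^ k) (t, ε))) = _
    rw [ih]
    set p := cs.simple i * cs.simple j with hp
    have hjj := cs.simple_mul_simple_self j
    have hii := cs.simple_mul_simple_self i
    have hpinv : p⁻¹ = cs.simple j * cs.simple i := by simp [hp]
    have hcomm : ∀ n : ℕ, cs.simple j * p ^ n = (p⁻¹) ^ n * cs.simple j := by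
      intro n
      have : SemiconjBy (cs.simple j) p (p⁻¹) := by
        simp [SemiconjBy, hp, mul_assoc]
      exact (this.pow_right n)
    have e1 : (p ^ k * t * (p ^ k)⁻¹ = cs.simple j) ↔ t = p⁻¹ ^ (2 * k) * cs.simple j := by
      rw [two_mul, pow_add, mul_assoc (p⁻¹ ^ k), ← hcomm, mul_inv_eq_iff_eq_mul, inv_pow,
        eq_inv_mul_iff_mul_eq]
    have e2 : (cs.simple j * (p ^ k * t * (p ^ k)⁻¹) * cs.simple j = cs.simple i) ↔
        t = p⁻¹ ^ (2 * k + 1) * cs.simple j := by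
      have : (p⁻¹ ^ (2 * k + 1) * cs.simple j) =
          (p ^ k)⁻¹ * (cs.simple j * cs.simple i * cs.simple j) * p ^ k := by
        rw [← hpinv, show 2 * k + 1 = k + 1 + k by ring, pow_add, pow_succ]
        simp only [mul_assoc, hcomm]
        simp only [inv_pow]
      rw [this]
      constructor
      · intro h
        rw [← h]
        simp [mul_assoc]
      · rintro rfl
        simp [mul_assoc]
    simp only [gen]
    rw [show 2 * (k + 1) = 2 * k + 1 + 1 by ring, Finset.sum_range_succ, Finset.sum_range_succ]
    simp only [e1, e2]
    ext
    · simp [hp, pow_succ', mul_assoc]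
    · simp only []; ring

theorem gen_liftable (cs : CoxeterSystem M W) : M.IsLiftable (gen cs) := by
  intro i j
  funext ⟨t, ε⟩
  rw [gen_pow]
  have h := cs.simple_mul_simple_pow i j
  rw [two_mul, Finset.sum_range_add]
  simp only [pow_add, inv_pow, h]
  have : ∀ a : ZMod 2, a + a = 0 := by decide
  simp [this]
  rfl

noncomputable def rep (cs : CoxeterSystem M W) : W →* Function.End (W × ZMod 2) :=
  cs.lift ⟨gen cs, gen_liftable cs⟩

noncomputable def eta (cs : CoxeterSystem M W) (w t : W) : ZMod 2 := (rep cs w (t, 0)).2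

theorem rep_simple (cs : CoxeterSystem M W) (i : B) : rep cs (cs.simple i) = gen cs i :=
  cs.lift_apply_simple (gen_liftable cs) i

theorem rep_apply (cs : CoxeterSystem M W) (w : W) :
    ∀ t ε, rep cs w (t, ε) = (w * t * w⁻¹, ε + eta cs w t) := by
  induction w using cs.simple_induction_left with
  | one =>
    intro t ε
    have : ∀ q, (1 : Function.End (W × ZMod 2)) q = q := fun _ => rfl
    simp [eta, this]
  | mul_simple_left w i ih =>
    intro t ε
    have h : ∀ q, rep cs (cs.simple i * w) q = gen cs i (rep cs w q) := by
      intro q; rw [map_mul, rep_simple]; rfl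
    have h0 : eta cs (cs.simple i * w) t = (gen cs i (rep cs w (t, 0))).2 := by
      rw [eta, h]
    rw [h0, h, ih, ih]
    simp [gen, mul_assoc, add_assoc]

theorem eta_mul (cs : CoxeterSystem M W) (a b t : W) :
    eta cs (a * b) t = eta cs b t + eta cs a (b * t * b⁻¹) := by
  have : eta cs (a * b) t = (rep cs a (rep cs b (t, 0))).2 := by
    rw [eta, map_mul]; rfl
  rw [this, rep_apply cs b, rep_apply cs a]; simp

theorem eta_simple (cs : CoxeterSystem M W) (i : B) (t : W) :
    eta cs (cs.simple i) t = if t = cs.simple i then 1 else 0 := by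
  rw [eta, rep_simple]; simp [gen]

theorem eta_one (cs : CoxeterSystem M W) (t : W) : eta cs 1 t = 0 := by
  rw [eta, map_one]; rfl

theorem mem_ris_of_eta (cs : CoxeterSystem M W) (ω : List B) (t : W)
    (h : eta cs (cs.wordProd ω) t ≠ 0) : t ∈ cs.rightInvSeq ω := by
  induction ω with
  | nil => simp [eta_one] at h
  | cons i ω ih =>
    rw [cs.wordProd_cons, eta_mul, eta_simple] at h
    by_cases h1 : eta cs (cs.wordProd ω) t = 0
    · rw [h1] at h
      have h2 : cs.wordProd ω * t * (cs.wordProd ω)⁻¹ = cs.simple i := by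
        by_contra h3; simp [h3] at h
      have : t = (cs.wordProd ω)⁻¹ * cs.simple i * cs.wordProd ω := by
        rw [← h2]; simp [mul_assoc]
      simp [CoxeterSystem.rightInvSeq, ← this]
    · simp [CoxeterSystem.rightInvSeq, ih h1]

theorem length_lt_of_eta (cs : CoxeterSystem M W) (w t : W) (h : eta cs w t ≠ 0) :
    cs.length (w * t) < cs.length w := by
  obtain ⟨ω, hω, rfl⟩ := cs.exists_isReduced w
  exact (cs.isRightInversion_of_mem_rightInvSeq hω (mem_ris_of_eta cs ω t h)).2

theorem eta_of_length_lt (cs : CoxeterSystem M W) (w t : W) (ht : cs.IsReflection t)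
    (h : cs.length (w * t) < cs.length w) : eta cs w t ≠ 0 := by
  intro h0
  have htt : eta cs t t = 1 := by
    obtain ⟨v, i, rfl⟩ := ht
    have e := eta_mul cs v v⁻¹ (v * cs.simple i * v⁻¹)
    rw [mul_inv_cancel, eta_one] at e
    have e' : v⁻¹ * (v * cs.simple i * v⁻¹) * v⁻¹⁻¹ = cs.simple i := by group
    rw [e'] at e
    rw [eta_mul, eta_mul, e', eta_simple]
    have e'' : cs.simple i * cs.simple i * (cs.simple i)⁻¹ = cs.simple i := by group
    rw [e'']
    simp only [if_true]
    rw [add_left_comm, ← e, add_zero]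
  have h1 : eta cs (w * t) t ≠ 0 := by
    rw [eta_mul, htt, show t * t * t⁻¹ = t by group, h0]; decide
  have h2 := length_lt_of_eta cs _ _ h1
  rw [mul_assoc, ht.mul_self, mul_one] at h2
  omega

/-- exchange for products -/
theorem exch (cs : CoxeterSystem M W) (a b : W) (i : B)
    (h1 : cs.length (a * b * cs.simple i) < cs.length (a * b))
    (h2 : cs.length b < cs.length (b * cs.simple i)) :
    cs.length (a * (b * cs.simple i * b⁻¹)) < cs.length a := by
  apply length_lt_of_eta
  have h := eta_of_length_lt cs _ _ (cs.isReflection_simple i) h1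
  rw [eta_mul] at h
  intro h0
  rw [h0, add_zero] at h
  have := length_lt_of_eta cs _ _ h
  omega

end exch

section parab

theorem simple_mem_par (cs : CoxeterSystem M W) {L : Set B} {b : B} (hb : b ∈ L) :
    cs.simple b ∈ par cs L := Subgroup.subset_closure ⟨b, hb, rfl⟩

theorem wordProd_mem_par (cs : CoxeterSystem M W) {L : Set B} (ω : List B) (h : ∀ b ∈ ω, b ∈ L) :
    cs.wordProd ω ∈ par cs L := by
  induction ω with
  | nil => simp [Subgroup.one_mem]
  | cons i ω ih =>
    rw [cs.wordProd_cons]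
    exact Subgroup.mul_mem _ (simple_mem_par cs (h i (by simp)))
      (ih fun b hb => h b (by simp [hb]))

theorem exch_word (cs : CoxeterSystem M W) (ω : List B) (i : B)
    (h : cs.length (cs.wordProd ω * cs.simple i) < cs.length (cs.wordProd ω)) :
    ∃ j < ω.length, cs.wordProd ω * cs.simple i = cs.wordProd (ω.eraseIdx j) := by
  have h1 := mem_ris_of_eta cs ω _ (eta_of_length_lt cs _ _ (cs.isReflection_simple i) h)
  obtain ⟨j, hj, hji⟩ := List.mem_iff_getElem.mp h1
  refine ⟨j, by simpa using hj, ?_⟩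
  rw [← cs.wordProd_mul_getD_rightInvSeq, List.getD_eq_getElem _ _ hj, hji]

theorem exists_reduced_par (cs : CoxeterSystem M W) {L : Set B} {w : W} (hw : w ∈ par cs L) :
    ∃ ω : List B, (∀ b ∈ ω, b ∈ L) ∧ cs.IsReduced ω ∧ w = cs.wordProd ω := by
  have key : ∀ x : W, ∀ b ∈ L,
      (∃ ω : List B, (∀ b ∈ ω, b ∈ L) ∧ cs.IsReduced ω ∧ x = cs.wordProd ω) →
      (∃ ω : List B, (∀ b ∈ ω, b ∈ L) ∧ cs.IsReduced ω ∧ x * cs.simple b = cs.wordProd ω) := by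
    rintro x b hb ⟨ω, hL, hr, rfl⟩
    rcases cs.length_mul_simple (cs.wordProd ω) b with h | h
    · refine ⟨ω ++ [b], ?_, ?_, ?_⟩
      · intro c hc
        rcases List.mem_append.1 hc with h | h
        · exact hL c h
        · rw [List.mem_singleton.1 h]; exact hb
      · rw [CoxeterSystem.IsReduced, cs.wordProd_append, cs.wordProd_singleton, h, hr.eq]; simp
      · rw [cs.wordProd_append, cs.wordProd_singleton]
    · obtain ⟨j, hj, e⟩ := exch_word cs ω b (by omega)
      refine ⟨ω.eraseIdx j, ?_, ?_, e⟩
      · intro c hc; exact hL c (List.mem_of_mem_eraseIdx hc)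
      · rw [CoxeterSystem.IsReduced, ← e]
        have := hr.eq
        have := List.length_eraseIdx_add_one hj
        omega
  induction hw using Subgroup.closure_induction_right with
  | one => exact ⟨[], by simp, by simp [CoxeterSystem.IsReduced], by simp⟩
  | mul_right x hx y hy ih =>
    obtain ⟨b, hb, rfl⟩ := hy
    exact key x b hb ih
  | mul_inv_cancel x hx y hy ih =>
    obtain ⟨b, hb, rfl⟩ := hy
    rw [cs.inv_simple]
    exact key x b hb ih

theorem exists_descent_par (cs : CoxeterSystem M W) {L : Set B} {w : W} (hw : w ∈ par cs L)
    (h1 : w ≠ 1) : ∃ b ∈ L, cs.length (w * cs.simple b) < cs.length w := by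
  obtain ⟨ω, hL, hr, rfl⟩ := exists_reduced_par cs hw
  rcases List.eq_nil_or_concat ω with rfl | ⟨ω', b, rfl⟩
  · simp at h1
  · refine ⟨b, hL b (by simp), ?_⟩
    rw [hr.eq, List.concat_eq_append, cs.wordProd_append, cs.wordProd_singleton,
      cs.simple_mul_simple_cancel_right]
    have := cs.length_wordProd_le ω'
    simp; omega

theorem par_induction (cs : CoxeterSystem M W) {L : Set B} {p : W → Prop} (one : p 1)
    (step : ∀ w ∈ par cs L, ∀ b ∈ L, cs.length (w * cs.simple b) = cs.length w + 1 → p w →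
      p (w * cs.simple b)) : ∀ w ∈ par cs L, p w := by
  have : ∀ n : ℕ, ∀ w ∈ par cs L, cs.length w = n → p w := by
    intro n
    induction n using Nat.strong_induction_on with
    | _ n ih =>
      intro w hw hn
      by_cases h1 : w = 1
      · rw [h1]; exact one
      obtain ⟨b, hb, hlt⟩ := exists_descent_par cs hw h1
      have hm := Subgroup.mul_mem _ hw (simple_mem_par cs hb)
      have h2 := step _ hm b hb ?_ (ih _ (by omega) _ hm rfl)
      · rwa [cs.simple_mul_simple_cancel_right] at h2
      · rw [cs.simple_mul_simple_cancel_right]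
        rcases cs.length_mul_simple w b with h | h <;> omega
  intro w hw
  exact this _ w hw rfl

theorem mem_of_simple_mem_par (cs : CoxeterSystem M W) {L : Set B} {b : B}
    (h : cs.simple b ∈ par cs L) : b ∈ L := by
  have h1 : cs.simple b ≠ 1 := by
    intro h; have := cs.length_simple b; rw [h] at this; simp at this
  obtain ⟨c, hc, hlt⟩ := exists_descent_par cs h h1
  rw [cs.length_simple, Nat.lt_one_iff, cs.length_eq_zero_iff, mul_eq_one_iff_eq_inv,
    cs.inv_simple] at hlt
  rwa [simple_inj cs hlt]

theorem length_mul_of_not_mem (cs : CoxeterSystem M W) {L : Set B} {b : B} (hb : b ∉ L)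
    {w : W} (hw : w ∈ par cs L) : cs.length (w * cs.simple b) = cs.length w + 1 := by
  rcases cs.length_mul_simple w b with h | h
  · exact h
  exfalso
  obtain ⟨ω, hL, hr, rfl⟩ := exists_reduced_par cs hw
  obtain ⟨j, hj, e⟩ := exch_word cs ω b (by omega)
  have h2 : cs.wordProd (ω.eraseIdx j) ∈ par cs L :=
    wordProd_mem_par cs _ fun c hc => hL c (List.mem_of_mem_eraseIdx hc)
  rw [← e] at h2
  exact hb (mem_of_simple_mem_par cs ((Subgroup.mul_mem_cancel_left _ hw).1 h2))

theorem length_mul_of_not_mem' (cs : CoxeterSystem M W) {L : Set B} {b : B} (hb : b ∉ L)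
    {w : W} (hw : w ∈ par cs L) : cs.length (cs.simple b * w) = cs.length w + 1 := by
  have := length_mul_of_not_mem cs hb (Subgroup.inv_mem _ hw)
  rwa [← cs.length_inv, mul_inv_rev, inv_inv, cs.inv_simple, cs.length_inv w] at this

/-- full descents -/
theorem length_of_descents (cs : CoxeterSystem M W) {L : Set B} {v : W}
    (hv : ∀ b ∈ L, cs.length (v * cs.simple b) < cs.length v) :
    ∀ w ∈ par cs L, cs.length (v * w⁻¹) + cs.length w = cs.length v := by
  apply par_induction
  · simp
  · intro w hw b hb h ih
    have h1 := exch cs (v * w⁻¹) w b (by simpa using hv b hb) (by omega)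
    have e : v * w⁻¹ * (w * cs.simple b * w⁻¹) = v * (w * cs.simple b)⁻¹ := by
      simp [mul_assoc]
    rw [e] at h1
    have := cs.length_le_length_mul_add_right v (w * cs.simple b)⁻¹
    rw [cs.length_inv] at this
    omega

/-- full ascents -/
theorem length_of_ascents (cs : CoxeterSystem M W) {L : Set B} {y : W}
    (hy : ∀ b ∈ L, cs.length y < cs.length (y * cs.simple b)) :
    ∀ w ∈ par cs L, cs.length (y * w) = cs.length y + cs.length w := by
  -- minimal element of the coset
  have hmin : ∀ z : W, (∀ v ∈ par cs L, cs.length z ≤ cs.length (z * v)) →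
      ∀ w ∈ par cs L, cs.length (z * w) = cs.length z + cs.length w := by
    intro z hz
    apply par_induction
    · simp
    · intro w hw b hb h ih
      rcases cs.length_mul_simple (z * w) b with h1 | h1
      · rw [← mul_assoc]; omega
      · have h2 := exch cs z w b (by omega) (by omega)
        have h3 := hz (w * cs.simple b * w⁻¹) (Subgroup.mul_mem _ (Subgroup.mul_mem _ hw
          (simple_mem_par cs hb)) (Subgroup.inv_mem _ hw))
        omega
  obtain ⟨v, hv, hvmin⟩ : ∃ v ∈ par cs L, ∀ v' ∈ par cs L,
      cs.length (y * v) ≤ cs.length (y * v') := by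
    obtain ⟨v, hv, h⟩ := exists_minimalFor_of_wellFoundedLT (fun v => v ∈ par cs L)
      (fun v => cs.length (y * v)) ⟨1, Subgroup.one_mem _⟩
    refine ⟨v, hv, fun v' hv' => ?_⟩
    rcases le_total (cs.length (y * v)) (cs.length (y * v')) with h1 | h1
    · exact h1
    · exact h hv' h1
  have hz := hmin (y * v) (by
    intro w hw; rw [mul_assoc]; exact hvmin _ (Subgroup.mul_mem _ hv hw))
  by_cases h1 : v⁻¹ = 1
  · rw [inv_eq_one] at h1
    rw [h1, mul_one] at hz
    exact hz
  · obtain ⟨b, hb, hlt⟩ := exists_descent_par cs (Subgroup.inv_mem _ hv) h1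
    have a1 := hz _ (Subgroup.inv_mem _ hv)
    have a2 := hz _ (Subgroup.mul_mem _ (Subgroup.inv_mem _ hv) (simple_mem_par cs hb))
    rw [← mul_assoc] at a2
    simp only [mul_inv_cancel_right] at a1 a2
    have := hy b hb
    omega

variable {cs : CoxeterSystem M W} {K : Set B} {y : W}

theorem IsLongest.descent (h : IsLongest cs K y) {b : B} (hb : b ∈ K) :
    cs.length (y * cs.simple b) < cs.length y :=
  lt_of_le_of_ne (h.2 _ (Subgroup.mul_mem _ h.1 (simple_mem_par cs hb)))
    (cs.length_mul_simple_ne _ _)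

theorem IsLongest.inv (h : IsLongest cs K y) : y⁻¹ = y := by
  have := length_of_descents cs (fun b hb => h.descent hb) y⁻¹ (Subgroup.inv_mem _ h.1)
  rw [cs.length_inv, inv_inv] at this
  have h2 : y * y = 1 := cs.length_eq_zero_iff.1 (by omega)
  exact inv_eq_of_mul_eq_one_left h2

theorem IsLongest.sq (h : IsLongest cs K y) : y * y = 1 := by
  nth_rw 1 [← h.inv]; simp

theorem IsLongest.length_mul (h : IsLongest cs K y) {w : W} (hw : w ∈ par cs K) :
    cs.length (y * w) + cs.length w = cs.length y := by
  have := length_of_descents cs (fun b hb => h.descent hb) w⁻¹ (Subgroup.inv_mem _ hw)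
  rwa [cs.length_inv, inv_inv] at this

theorem IsLongest.conj (h : IsLongest cs K y) {b : B} (hb : b ∈ K) :
    ∃ c ∈ K, y * cs.simple b * y = cs.simple c := by
  have hs := simple_mem_par cs hb
  have h1 := h.length_mul hs
  have h2 := h.length_mul (Subgroup.mul_mem _ hs h.1)
  have h3 : cs.length (cs.simple b * y) = cs.length (y * cs.simple b) := by
    rw [← cs.length_inv, mul_inv_rev, cs.inv_simple, h.inv]
  rw [cs.length_simple] at h1
  obtain ⟨c, hc⟩ := cs.length_eq_one_iff.1
    (show cs.length (y * (cs.simple b * y)) = 1 by omega)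
  refine ⟨c, mem_of_simple_mem_par cs (L := K) ?_, by rw [mul_assoc, hc]⟩
  rw [← hc]
  exact Subgroup.mul_mem _ h.1 (Subgroup.mul_mem _ hs h.1)

theorem length_conj_le (cs : CoxeterSystem M W) {L : Set B} {y : W}
    (h : ∀ b ∈ L, ∃ c, y * cs.simple b * y⁻¹ = cs.simple c) :
    ∀ w ∈ par cs L, cs.length (y * w * y⁻¹) ≤ cs.length w := by
  apply par_induction
  · simp
  · intro w hw b hb hl ih
    obtain ⟨c, hc⟩ := h b hb
    have e : y * (w * cs.simple b) * y⁻¹ = y * w * y⁻¹ * cs.simple c := by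
      rw [← hc]; simp [mul_assoc]
    rw [e]
    have := cs.length_mul_le (y * w * y⁻¹) (cs.simple c)
    rw [cs.length_simple] at this
    omega

end parab

theorem statement_17 (cs : CoxeterSystem M W) [Finite W] (wS : W)
    (hwS : ∀ w : W, cs.length w ≤ cs.length wS)
    (s t : B) (hst : cs.simple s ≠ wS * cs.simple t * wS)
    (wco : B → W) (hwco : ∀ c, IsLongest cs (Set.univ \ {c}) (wco c))
    (wco2 : B → B → W) (hwco2 : ∀ c c', IsLongest cs (Set.univ \ {c, c'}) (wco2 c c'))
    (u : ℕ → B)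
    (hurec : ∀ i, cs.simple (u (i + 2)) = wco (u (i + 1)) * cs.simple (u i) * wco (u (i + 1)))
    (x : ℕ → W)
    (hx0 : x 0 = wco2 (u 0) (u 1))
    (hx : ∀ i, x (i + 1) = x i * wco2 (u i) (u (i + 1)) * wco (u (i + 1)))
    (d : ℕ)
    (hd : ∀ i ≤ d, (cs.length (x (i + 1)) : ℤ) =
      (cs.length (x i) : ℤ) - cs.length (wco2 (u i) (u (i + 1))) + cs.length (wco (u (i + 1))))
    (hdmax : ∀ k : ℕ, (∀ i ≤ k, (cs.length (x (i + 1)) : ℤ) =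
        (cs.length (x i) : ℤ) - cs.length (wco2 (u i) (u (i + 1)))
          + cs.length (wco (u (i + 1)))) → k ≤ d)
    (hu0 : cs.simple (u 0) = wS * cs.simple t * wS)
    (hu1 : u 1 = s) :
    cs.simple (u (d + 2)) = wS * cs.simple s * wS := by
  have inj := simple_inj cs
  have hne : ∀ i, u i ≠ u (i + 1) := by
    intro i
    induction i with
    | zero => intro h; apply hst; rw [← hu0, h, ← hu1]
    | succ i ih =>
      obtain ⟨c, hc, e⟩ := (hwco (u (i + 1))).conj (b := u i) (by simp [ih])
      rw [← hurec i] at e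
      rw [inj e]
      intro h
      simp [h] at hc
  let y : ℕ → W := fun i => x i * wco2 (u i) (u (i + 1))
  have hL := fun i => hwco2 (u i) (u (i + 1))
  have hK := fun i => hwco (u (i + 1))
  have hxy : ∀ i, x i = y i * wco2 (u i) (u (i + 1)) := by
    intro i; simp only [y]; rw [mul_assoc, (hL i).sq, mul_one]
  have hxs : ∀ i, x (i + 1) = y i * wco (u (i + 1)) := hx
  have hys : ∀ i, y (i + 1) = y i * (wco (u (i + 1)) * wco2 (u (i + 1)) (u (i + 2))) := by
    intro i; rw [← mul_assoc, ← hxs]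
  have hy0 : y 0 = 1 := by simp only [y]; rw [hx0]; exact (hL 0).sq
  have hLK : ∀ i, par cs (Set.univ \ {u i, u (i + 1)}) ≤ par cs (Set.univ \ {u (i + 1)}) := by
    intro i
    apply Subgroup.closure_mono
    apply Set.image_mono
    intro b hb
    simp at hb ⊢
    exact hb.2
  have hLK' : ∀ i, par cs (Set.univ \ {u (i + 1), u (i + 2)}) ≤
      par cs (Set.univ \ {u (i + 1)}) := by
    intro i
    apply Subgroup.closure_mono
    apply Set.image_mono
    intro b hb
    simp at hb ⊢
    exact hb.1
  -- conjugation by `y i`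
  have hP : ∀ i, ∀ b ∈ (Set.univ \ {u i, u (i + 1)} : Set B),
      ∃ c ∈ (Set.univ \ {u 0, u 1} : Set B), y i * cs.simple b * (y i)⁻¹ = cs.simple c := by
    intro i
    induction i with
    | zero => intro b hb; exact ⟨b, hb, by simp [hy0]⟩
    | succ i ih =>
      intro b hb
      obtain ⟨b1, hb1, e1⟩ := (hL (i + 1)).conj hb
      have hb1' : b1 ∈ (Set.univ \ {u (i + 1)} : Set B) := by
        simp at hb1 ⊢; exact hb1.1
      obtain ⟨b2, hb2, e2⟩ := (hK i).conj hb1'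
      have hb2' : b2 ∈ (Set.univ \ {u i, u (i + 1)} : Set B) := by
        simp at hb2 hb1 ⊢
        refine ⟨?_, hb2⟩
        rintro rfl
        apply hb1.2
        apply inj
        rw [hurec, ← e2]
        have := (hK i).sq
        simp only [mul_assoc, this, mul_one]
        rw [← mul_assoc, this, one_mul]
      obtain ⟨c, hc, e⟩ := ih b2 hb2'
      refine ⟨c, hc, ?_⟩
      rw [← e, ← e2, ← e1, hys]
      simp only [mul_inv_rev, (hK i).inv, (hL (i + 1)).inv, mul_assoc]
  -- consequence of reducedness at step `i`
  have hstep : ∀ i ≤ d, (∀ b ∈ (Set.univ \ {u i, u (i + 1)} : Set B),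
      cs.length (y i) < cs.length (y i * cs.simple b)) →
      ∀ w ∈ par cs (Set.univ \ {u (i + 1)}),
        cs.length (y i * w) = cs.length (y i) + cs.length w := by
    intro i hi hQ w hw
    have h1 := hd i hi
    have h2 := length_of_ascents cs hQ _ (hL i).1
    rw [← hxy] at h2
    rw [hxs] at h1
    have h3 := (hK i).length_mul (Subgroup.inv_mem _ hw)
    rw [← cs.length_inv, mul_inv_rev, inv_inv, (hK i).inv, cs.length_inv] at h3
    have h4 := cs.length_mul_le (y i * w) (w⁻¹ * wco (u (i + 1)))
    have h5 := cs.length_mul_le (y i) w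
    have e : y i * w * (w⁻¹ * wco (u (i + 1))) = y i * wco (u (i + 1)) := by
      simp [mul_assoc]
    rw [e] at h4
    have e' : cs.length (w⁻¹ * wco (u (i + 1))) = cs.length (wco (u (i + 1)) * w) := by
      rw [← cs.length_inv, mul_inv_rev, inv_inv, (hK i).inv]
    have h6 := (hK i).length_mul hw
    omega
  have hQ : ∀ i ≤ d + 1, ∀ b ∈ (Set.univ \ {u i, u (i + 1)} : Set B),
      cs.length (y i) < cs.length (y i * cs.simple b) := by
    intro i
    induction i with
    | zero => intro _ b _; simp [hy0]
    | succ i ih =>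
      intro hi b hb
      have hs := hstep i (by omega) (ih (by omega))
      have m1 := hLK' i (hL (i + 1)).1
      have m2 := hLK' i (simple_mem_par cs hb)
      have m3 := Subgroup.mul_mem _ m1 m2
      rw [hys, mul_assoc (y i), hs _ (Subgroup.mul_mem _ (hK i).1 m1), mul_assoc (wco _),
        hs _ (Subgroup.mul_mem _ (hK i).1 m3)]
      have a1 := (hK i).length_mul m1
      have a2 := (hK i).length_mul m3
      have a3 := (hL (i + 1)).descent hb
      simp only [Nat.add_assoc, Nat.reduceAdd] at a1 a2 a3 ⊢
      omega
  have hstep' := fun i hi => hstep i hi (hQ i (by omega))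
  -- the two extra descents
  have hD1 : cs.length (y (d + 1) * cs.simple (u (d + 1))) < cs.length (y (d + 1)) := by
    by_contra hcon
    have hA : ∀ b ∈ (Set.univ \ {u (d + 2)} : Set B),
        cs.length (y (d + 1)) < cs.length (y (d + 1) * cs.simple b) := by
      intro b hb
      by_cases h : b = u (d + 1)
      · rw [h]
        exact lt_of_le_of_ne (not_lt.1 hcon) (cs.length_mul_simple_ne _ _).symm
      · apply hQ _ le_rfl
        simp at hb ⊢
        exact ⟨h, hb⟩
    have h1 := length_of_ascents cs hA _ (hK (d + 1)).1
    have h2 := length_of_ascents cs (hQ (d + 1) le_rfl) _ (hL (d + 1)).1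
    rw [← hxs] at h1
    rw [← hxy] at h2
    have := hdmax (d + 1) (by
      intro i hi
      rcases Nat.lt_or_ge d i with h | h
      · have : i = d + 1 := by omega
        subst this
        rw [h1, h2]
        push_cast
        ring
      · exact hd i h)
    omega
  have hD2 : cs.length (y (d + 1) * cs.simple (u (d + 2))) < cs.length (y (d + 1)) := by
    have m1 := hLK' d (hL (d + 1)).1
    have m2 : cs.simple (u (d + 2)) ∈ par cs (Set.univ \ {u (d + 1)}) :=
      simple_mem_par cs (by simp [(hne (d + 1)).symm])
    have m3 := Subgroup.mul_mem _ m1 m2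
    have hs := hstep' d le_rfl
    rw [hys, mul_assoc (y d), hs _ (Subgroup.mul_mem _ (hK d).1 m1), mul_assoc (wco _),
      hs _ (Subgroup.mul_mem _ (hK d).1 m3)]
    have a1 := (hK d).length_mul m1
    have a2 := (hK d).length_mul m3
    have a3 := length_mul_of_not_mem cs (b := u (d + 2)) (by simp) (hL (d + 1)).1
    simp only [Nat.add_assoc, Nat.reduceAdd] at a1 a2 a3 ⊢
    omega
  have hLx := length_of_ascents cs (hQ (d + 1) le_rfl)
  have hconj := length_conj_le cs (y := y (d + 1))
    (fun b hb => (hP (d + 1) b hb).imp fun c hc => hc.2) _ (hL (d + 1)).1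
  have hxe : x (d + 1) = y (d + 1) * wco2 (u (d + 1)) (u (d + 1 + 1)) * (y (d + 1))⁻¹ *
      y (d + 1) := by rw [hxy]; simp
  have hdesc : ∀ b ∈ (Set.univ : Set B),
      cs.length (x (d + 1) * cs.simple b) < cs.length (x (d + 1)) := by
    have hl := hLx _ (hL (d + 1)).1
    rw [← hxy] at hl
    have hboth : ∀ b, cs.length (y (d + 1) * cs.simple b) < cs.length (y (d + 1)) →
        cs.length (x (d + 1) * cs.simple b) < cs.length (x (d + 1)) := by
      intro b hb
      have := cs.length_mul_le (y (d + 1) * wco2 (u (d + 1)) (u (d + 1 + 1)) * (y (d + 1))⁻¹)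
        (y (d + 1) * cs.simple b)
      rw [← mul_assoc, ← hxe] at this
      omega
    intro b _
    by_cases h1 : b = u (d + 1)
    · rw [h1]; exact hboth _ hD1
    by_cases h2 : b = u (d + 2)
    · rw [h2]; exact hboth _ hD2
    have hb : b ∈ (Set.univ \ {u (d + 1), u (d + 1 + 1)} : Set B) := by
      simp; exact ⟨h1, h2⟩
    have h3 := hLx _ (Subgroup.mul_mem _ (hL (d + 1)).1 (simple_mem_par cs hb))
    rw [← mul_assoc, ← hxy] at h3
    have h4 := (hL (d + 1)).descent hb
    omega
  have htop : ∀ w : W, w ∈ par cs (Set.univ : Set B) := by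
    intro w
    rw [par, Set.image_univ, cs.subgroup_closure_range_simple]
    trivial
  have hS : IsLongest cs (Set.univ : Set B) wS := ⟨htop _, fun w _ => hwS w⟩
  have hxS : x (d + 1) = wS := by
    have h1 := length_of_descents cs hdesc wS (htop _)
    have h2 := hwS (x (d + 1))
    have h3 : x (d + 1) * wS⁻¹ = 1 := cs.length_eq_zero_iff.1 (by omega)
    exact mul_inv_eq_one.1 h3
  have hyd : y d = wS * wco (u (d + 1)) := by
    rw [← hxS, hxs, mul_assoc, (hK d).sq, mul_one]
  have hd1 : 1 ≤ d := by
    by_contra h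
    have h0 : d = 0 := by omega
    subst h0
    have h1 : wS = wco (u 1) := by rw [← hxS, hxs, hy0, one_mul]
    have h2 := length_mul_of_not_mem cs (b := u 1) (by simp) (hK 0).1
    have h3 := hS.descent (Set.mem_univ (u 1))
    rw [h1] at h3
    simp only [Nat.zero_add] at h2
    omega
  -- left descent `u 0`
  have hleft : ∀ i, i + 1 ≤ d → cs.length (cs.simple (u 0) * y (i + 1)) < cs.length (y (i + 1)) := by
    intro i
    induction i with
    | zero =>
      intro _
      have e : cs.simple (u 0) * y 1 = wco (u 1) * (cs.simple (u 2) * wco2 (u 1) (u 2)) := by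
        have h0 := hys 0
        have h1 := hurec 0
        have h2 := (hK 0).sq
        simp only [Nat.zero_add] at h0 h1 h2
        rw [h0, hy0, one_mul, h1]
        simp only [← mul_assoc]
        rw [h2, one_mul]
      have m1 := hLK' 0 (hL 1).1
      have m2 : cs.simple (u 2) ∈ par cs (Set.univ \ {u (0 + 1)}) :=
        simple_mem_par cs (by simpa using (hne 1).symm)
      have a1 := (hK 0).length_mul m1
      have a2 := (hK 0).length_mul (Subgroup.mul_mem _ m2 m1)
      have a3 := length_mul_of_not_mem' cs (b := u 2) (by simp) (hL 1).1
      have h0 := hys 0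
      simp only [Nat.zero_add, Nat.reduceAdd] at h0 a1 a2 a3 ⊢
      rw [e, h0, hy0, one_mul]
      omega
    | succ i ih =>
      intro hi
      have h1 := ih (by omega)
      have h2 := hstep' (i + 1) (by omega) _
        (Subgroup.mul_mem _ (hK (i + 1)).1 (hLK' (i + 1) (hL (i + 1 + 1)).1))
      have h3 := cs.length_mul_le (cs.simple (u 0) * y (i + 1))
        (wco (u (i + 1 + 1)) * wco2 (u (i + 1 + 1)) (u (i + 1 + 1 + 1)))
      rw [mul_assoc (cs.simple (u 0))] at h3
      have h4 : y (i + 1 + 1) = y (i + 1) *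
        (wco (u (i + 1 + 1)) * wco2 (u (i + 1 + 1)) (u (i + 1 + 1 + 1))) := hys (i + 1)
      rw [h4]
      omega
  have hleftd := hleft (d - 1) (by omega)
  rw [show d - 1 + 1 = d by omega, hyd] at hleftd
  obtain ⟨c, -, hc⟩ := hS.conj (Set.mem_univ (u 0))
  have hcu : c = u (d + 1) := by
    by_contra hne'
    have e : cs.simple (u 0) * (wS * wco (u (d + 1))) = wS * (cs.simple c * wco (u (d + 1))) := by
      rw [← hc]
      simp only [← mul_assoc]
      rw [hS.sq, one_mul]
    have hcK : c ∈ (Set.univ \ {u (d + 1)} : Set B) := by simp [hne']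
    have h1 := hS.length_mul (htop (wco (u (d + 1))))
    have h2 := hS.length_mul (htop (cs.simple c * wco (u (d + 1))))
    have h3 := (hK d).descent hcK
    rw [← cs.length_inv, mul_inv_rev, cs.inv_simple, (hK d).inv] at h3
    rw [e] at hleftd
    omega
  obtain ⟨c', -, hc'⟩ := hS.conj (Set.mem_univ (u 1))
  rw [← hu1, hc']
  have hback : wS * cs.simple c' * wS = cs.simple (u 1) := by
    rw [← hc']
    simp only [mul_assoc, hS.sq, mul_one]
    rw [← mul_assoc, hS.sq, one_mul]
  by_cases h1 : c' = u (d + 1)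
  · exfalso
    rw [h1, ← hcu, ← hc] at hc'
    have := mul_left_cancel (mul_right_cancel hc')
    exact hne 0 (inj this).symm
  by_cases h2 : c' = u (d + 2)
  · rw [h2]
  exfalso
  obtain ⟨c1, hc1, e1⟩ := (hL (d + 1)).conj (b := c') (by simp; exact ⟨h1, h2⟩)
  obtain ⟨c2, hc2, e2⟩ := hP (d + 1) c1 hc1
  have e3 : wS * cs.simple c' * wS = cs.simple c2 := by
    nth_rw 2 [← hS.inv]
    rw [← e2, ← e1, ← hxS, hxy]
    simp only [mul_inv_rev, (hL (d + 1)).inv, mul_assoc]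
  rw [hback] at e3
  have := inj e3
  rw [← this] at hc2
  simp at hc2

end CoxeterAtoms
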